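/- Let -∞ < a < b < ∞ and let f be continuously differentiable on [a,b]. Then for every t ∈ (a,b], lim_{α→1⁻} ᶜ_aDᵅf(t) = f'(t), i.e. the Caputo fractional derivative of f of order α converges pointwise on (a,b] to the ordinary derivative as α increases to 1. -/

import Mathlib

open MeasureTheory Filter Set

/-- Caputo fractional derivative of order `α` with base point `a`,
expressed in terms of the derivative `f'`. -/
noncomputable def caputoD (a α : ℝ) (f' : ℝ → ℝ) (t : ℝ) : ℝ :=
  (1 / Real.Gamma (1 - α)) * ∫ τ in a..t, f' τ * (t - τ) ^ (-α)

theorem one_div_Gamma_one_sub {α : ℝ} (hα : α < 1) :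
    1 / Real.Gamma (1 - α) = (1 - α) / Real.Gamma (2 - α) := by
  have h : 0 < 1 - α := by linarith
  have hG : Real.Gamma (2 - α) = (1 - α) * Real.Gamma (1 - α) := by
    rw [← Real.Gamma_add_one h.ne']; ring_nf
  rw [hG]
  have := (Real.Gamma_pos_of_pos h).ne'
  field_simp

theorem tendsto_Gamma_two_sub :
    Tendsto (fun α : ℝ => Real.Gamma (2 - α)) (nhdsWithin 1 (Iio 1)) (nhds 1) := by
  have h1 : ContinuousAt Real.Gamma (2 - 1) :=
    (Real.differentiableOn_Gamma_Ioi.differentiableAt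
      (Ioi_mem_nhds (by norm_num))).continuousAt
  have h2 : ContinuousAt (fun α : ℝ => Real.Gamma (2 - α)) 1 :=
    ContinuousAt.comp (f := fun α : ℝ => 2 - α) h1 (by fun_prop)
  have h3 := h2.tendsto
  norm_num at h3
  exact h3.mono_left nhdsWithin_le_nhds

theorem tendsto_one_div_Gamma_one_sub :
    Tendsto (fun α : ℝ => 1 / Real.Gamma (1 - α)) (nhdsWithin 1 (Iio 1)) (nhds 0) := by
  have h : Tendsto (fun α : ℝ => 1 - α) (nhdsWithin 1 (Iio 1)) (nhds 0) := by
    have : ContinuousAt (fun α : ℝ => 1 - α) 1 := by fun_prop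
    simpa using this.tendsto.mono_left nhdsWithin_le_nhds
  have h' := h.div tendsto_Gamma_two_sub one_ne_zero
  rw [zero_div] at h'
  refine h'.congr' ?_
  filter_upwards [self_mem_nhdsWithin] with α hα
  exact (one_div_Gamma_one_sub hα).symm

theorem integral_sub_rpow_neg (a t : ℝ) {α : ℝ} (hα : α < 1) :
    ∫ τ in a..t, (t - τ) ^ (-α) = (t - a) ^ (1 - α) / (1 - α) := by
  rw [intervalIntegral.integral_comp_sub_left (fun x : ℝ => x ^ (-α)) t,
    integral_rpow (Or.inl (by linarith)), sub_self, neg_add_eq_sub,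
    Real.zero_rpow (by linarith), sub_zero]

theorem tendsto_integral_caputo_kernel {a t : ℝ} (hat : a < t) :
    Tendsto (fun α : ℝ => ∫ τ in Ioc a t, 1 / Real.Gamma (1 - α) * (t - τ) ^ (-α))
      (nhdsWithin 1 (Iio 1)) (nhds 1) := by
  have h : Tendsto (fun α : ℝ => (t - a) ^ (1 - α)) (nhdsWithin 1 (Iio 1)) (nhds 1) := by
    have : ContinuousAt (fun α : ℝ => (t - a) ^ (1 - α)) 1 :=
      ContinuousAt.rpow (by fun_prop) (by fun_prop) (Or.inl (sub_pos.2 hat).ne')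
    simpa using this.tendsto.mono_left nhdsWithin_le_nhds
  have h' := h.div tendsto_Gamma_two_sub one_ne_zero
  rw [div_one] at h'
  refine h'.congr' ?_
  filter_upwards [self_mem_nhdsWithin] with α hα
  have hα' : 1 - α ≠ 0 := (sub_pos.2 hα).ne'
  rw [← intervalIntegral.integral_of_le hat.le, intervalIntegral.integral_const_mul,
    integral_sub_rpow_neg a t hα, one_div_Gamma_one_sub hα]
  simp only [Pi.div_apply]
  field_simp

theorem tendstoUniformlyOn_caputo_kernel (a t : ℝ) {u : Set ℝ} (hu : IsOpen u) (htu : t ∈ u) :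
    TendstoUniformlyOn (fun α τ : ℝ => 1 / Real.Gamma (1 - α) * (t - τ) ^ (-α)) 0
      (nhdsWithin 1 (Iio 1)) (Ioc a t \ u) := by
  obtain ⟨δ, hδ, hball⟩ := Metric.isOpen_iff.1 hu t htu
  set ε := min δ 1
  have hε : 0 < ε := lt_min hδ one_pos
  have hlim : Tendsto (fun α : ℝ => 1 / Real.Gamma (1 - α) * ε ^ (-1 : ℝ))
      (nhdsWithin 1 (Iio 1)) (nhds 0) := by
    simpa using tendsto_one_div_Gamma_one_sub.mul_const (ε ^ (-1 : ℝ))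
  rw [Metric.tendstoUniformlyOn_iff]
  intro η hη
  filter_upwards [hlim.eventually (gt_mem_nhds hη), self_mem_nhdsWithin,
    nhdsWithin_le_nhds (Ioi_mem_nhds (zero_lt_one (α := ℝ)))] with α hαη hα1 hα0 τ hτ
  simp only [mem_Iio, mem_Ioi] at hα1 hα0
  have hG : 0 ≤ 1 / Real.Gamma (1 - α) :=
    one_div_nonneg.2 (Real.Gamma_pos_of_pos (sub_pos.2 hα1)).le
  have hτt : 0 ≤ t - τ := sub_nonneg.2 hτ.1.2
  have hετ : ε ≤ t - τ := by
    by_contra! hlt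
    refine hτ.2 (hball ?_)
    rw [Metric.mem_ball, dist_comm, Real.dist_eq, abs_of_nonneg hτt]
    exact hlt.trans_le (min_le_left _ _)
  rw [Pi.zero_apply, dist_zero_left, Real.norm_of_nonneg (mul_nonneg hG (Real.rpow_nonneg hτt _))]
  refine lt_of_le_of_lt (mul_le_mul_of_nonneg_left ?_ hG) hαη
  calc (t - τ) ^ (-α) ≤ ε ^ (-α) :=
        Real.rpow_le_rpow_of_nonpos hε hετ (by linarith)
    _ ≤ ε ^ (-1 : ℝ) :=
        Real.rpow_le_rpow_of_exponent_ge hε (min_le_right _ _) (by linarith)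

/-- For `f ∈ C¹[a,b]`, `ᶜ_aDᵅf(t) → f'(t)` as `α → 1⁻`, for every `t ∈ (a,b]`. -/
theorem caputo_pointwise_tendsto (a b : ℝ) (hab : a < b) (f f' : ℝ → ℝ)
    (hderiv : ∀ t ∈ Set.Icc a b, HasDerivWithinAt f (f' t) (Set.Icc a b) t)
    (hcont : ContinuousOn f' (Set.Icc a b)) :
    ∀ t ∈ Set.Ioc a b,
      Tendsto (fun α => caputoD a α f' t) (nhdsWithin 1 (Set.Iio 1)) (nhds (f' t)) := by
  intro t ht
  have hsub : Icc a t ⊆ Icc a b := Icc_subset_Icc_right ht.2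
  have key := tendsto_setIntegral_peak_smul_of_integrableOn_of_tendsto (μ := volume)
    (s := Ioc a t) (t := Ioc a t) (x₀ := t) (g := f') (a := f' t) (l := nhdsWithin 1 (Iio 1))
    (φ := fun α τ : ℝ => 1 / Real.Gamma (1 - α) * (t - τ) ^ (-α))
    measurableSet_Ioc measurableSet_Ioc Subset.rfl self_mem_nhdsWithin (by simp) ?_
    (fun u hu htu => tendstoUniformlyOn_caputo_kernel a t hu htu)
    (tendsto_integral_caputo_kernel ht.1)
    (Eventually.of_forall fun α => by
      have : Measurable fun τ : ℝ => 1 / Real.Gamma (1 - α) * (t - τ) ^ (-α) := by fun_prop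
      exact this.aestronglyMeasurable)
    ((hcont.mono hsub).integrableOn_Icc.mono_set Ioc_subset_Icc_self)
    ((hcont t (Ioc_subset_Icc_self ht)).mono (Ioc_subset_Icc_self.trans hsub))
  · refine key.congr fun α => ?_
    rw [caputoD, ← intervalIntegral.integral_const_mul, intervalIntegral.integral_of_le ht.1.le]
    congr 1 with τ
    rw [smul_eq_mul]
    ring
  · filter_upwards [self_mem_nhdsWithin] with α hα τ hτ
    exact mul_nonneg (one_div_nonneg.2 (Real.Gamma_pos_of_pos (sub_pos.2 hα)).le)
      (Real.rpow_nonneg (sub_nonneg.2 hτ.2) _)
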